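/- Let C ∈ ℝ^{K×n}, D ∈ ℝ^{K×n} with all entries of D nonnegative, and d ∈ ℝ^K. Suppose (z, y, t) ∈ ℝⁿ × ℝⁿ × ℝ^K satisfies Cz + Dy − d ≤ t componentwise, z_i² ≤ y_i for all i, and t ≥ 0. Then for every λ ∈ ℝ^K with 0 ≤ λ ≤ 1 componentwise and (Dᵀλ)_i > 0 for all i, one has −(1/4) Σᵢ ((Cᵀλ)ᵢ)² / (Dᵀλ)ᵢ − dᵀλ ≤ Σ_j t_j. (Weak duality between the lifted primal problem and its box-constrained dual.) -/

import Mathlib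

open Matrix

theorem stmt11 {K n : ℕ} (C D : Matrix (Fin K) (Fin n) ℝ)
    (hD : ∀ k i, 0 ≤ D k i) (d : Fin K → ℝ)
    (z y : Fin n → ℝ) (t : Fin K → ℝ)
    (hcon : ∀ k, C.mulVec z k + D.mulVec y k - d k ≤ t k)
    (hquad : ∀ i, (z i) ^ 2 ≤ y i)
    (ht : ∀ k, 0 ≤ t k)
    (lam : Fin K → ℝ) (hl0 : ∀ k, 0 ≤ lam k) (hl1 : ∀ k, lam k ≤ 1)
    (hpos : ∀ i, 0 < Dᵀ.mulVec lam i) :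
    -(1 / 4) * (∑ i, (Cᵀ.mulVec lam i) ^ 2 / Dᵀ.mulVec lam i)
        - (∑ k, d k * lam k) ≤ ∑ j, t j := by
  have hswap (A : Matrix (Fin K) (Fin n) ℝ) (v : Fin n → ℝ) :
      ∑ k, lam k * A.mulVec v k = ∑ i, Aᵀ.mulVec lam i * v i := by
    have h := dotProduct_mulVec lam A v
    rwa [← mulVec_transpose] at h
  have hweighted : ∑ k, lam k * (C.mulVec z k + D.mulVec y k - d k) ≤ ∑ k, t k :=
    Finset.sum_le_sum fun k _ =>
      (mul_le_mul_of_nonneg_left (hcon k) (hl0 k)).trans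
        (mul_le_of_le_one_left (ht k) (hl1 k))
  have hsplit : ∑ k, lam k * (C.mulVec z k + D.mulVec y k - d k) =
      ∑ i, (Cᵀ.mulVec lam i * z i + Dᵀ.mulVec lam i * y i) - ∑ k, d k * lam k := by
    rw [Finset.sum_add_distrib, ← hswap, ← hswap, ← Finset.sum_add_distrib,
      ← Finset.sum_sub_distrib]
    exact Finset.sum_congr rfl fun k _ => by ring
  have hsquare : -(1 / 4) * (∑ i, (Cᵀ.mulVec lam i) ^ 2 / Dᵀ.mulVec lam i) ≤
      ∑ i, (Cᵀ.mulVec lam i * z i + Dᵀ.mulVec lam i * y i) := by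
    rw [Finset.mul_sum]
    refine Finset.sum_le_sum fun i _ => ?_
    have he := hpos i
    have hy := mul_le_mul_of_nonneg_left (hquad i) he.le
    generalize Cᵀ.mulVec lam i = c at *
    generalize Dᵀ.mulVec lam i = e at *
    have hcomplete : c * z i + e * z i ^ 2 + 1 / 4 * (c ^ 2 / e) =
        e * (z i + c / (2 * e)) ^ 2 := by
      field_simp
      ring
    have hnonneg : 0 ≤ e * (z i + c / (2 * e)) ^ 2 := by positivity
    linarith
  linarith
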